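/- The alternating sum of duality operations is an antipode for the Harish-Chandra bialgebra structure: for every n ≥ 1 and f ∈ C_n, Σ_{k=0}^{n} (-1)^k R^n_{k,n-k}( (𝒟_k ⊗ id)(*R^n_{k,n-k} f) ) = 0, where (𝒟_k ⊗ id) applies the duality operation 𝒟_k to *R^n_{k,n-k} f in its first variable (for each fixed second argument), and where R^n_{0,n}, R^n_{n,0}, *R^n_{0,n}, *R^n_{n,0} are the identity (so the k = 0 term is f and the k = n term is (-1)^n 𝒟_n f). -/

import Mathlib

open Matrix BigOperators

namespace HCPaper

open scoped Classical

/-- `gl F n` : the additive group of `n × n` matrices over `F`. -/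
abbrev gl (F : Type) (n : ℕ) := Matrix (Fin n) (Fin n) F

variable {F : Type} [Field F] [Fintype F] [DecidableEq F]

/-- Conjugation (adjoint) action of `GL_n(F)` on `gl_n(F)`. -/
def conjM {n : ℕ} (g : Matrix.GeneralLinearGroup (Fin n) F) (x : gl F n) : gl F n :=
  (g : Matrix (Fin n) (Fin n) F) * x * ((g⁻¹ : Matrix.GeneralLinearGroup (Fin n) F) : Matrix (Fin n) (Fin n) F)

/-- A function `f : gl_n(F) → ℂ` is invariant if it is constant on `GL_n(F)`-conjugacy orbits. -/
def Invariant (n : ℕ) (f : gl F n → ℂ) : Prop :=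
  ∀ (g : Matrix.GeneralLinearGroup (Fin n) F) (x : gl F n), f (conjM g x) = f x

/-- Invariance for functions on `gl_k(F) × gl_l(F)` under `GL_k(F) × GL_l(F)`. -/
def Invariant₂ (k l : ℕ) (h : gl F k × gl F l → ℂ) : Prop :=
  ∀ (g₁ : Matrix.GeneralLinearGroup (Fin k) F) (g₂ : Matrix.GeneralLinearGroup (Fin l) F)
    (x : gl F k) (y : gl F l), h (conjM g₁ x, conjM g₂ y) = h (x, y)

/-- Transport of matrices along an equality of sizes. -/
def castM {m n : ℕ} (h : m = n) (x : gl F m) : gl F n :=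
  Matrix.reindex (finCongr h) (finCongr h) x

/-- Transport of functions along an equality of sizes. -/
def castFun {m n : ℕ} (h : m = n) (f : gl F m → ℂ) : gl F n → ℂ :=
  fun x => f (castM h.symm x)

/-- The block upper-triangular matrix `[x u; 0 y]`, viewed in `gl_{k+l}(F)`. -/
def but (k l : ℕ) (x : gl F k) (u : Matrix (Fin k) (Fin l) F) (y : gl F l) : gl F (k + l) :=
  Matrix.reindex finSumFinEquiv finSumFinEquiv (Matrix.fromBlocks x u 0 y)

/-- The block lower-triangular matrix `[x 0; v y]`, viewed in `gl_{k+l}(F)`. -/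
def blt (k l : ℕ) (x : gl F k) (v : Matrix (Fin l) (Fin k) F) (y : gl F l) : gl F (k + l) :=
  Matrix.reindex finSumFinEquiv finSumFinEquiv (Matrix.fromBlocks x 0 v y)

/-- View a matrix in `gl_{k+l}(F)` as a `2 × 2`-block matrix. -/
def blk (k l : ℕ) (m : gl F (k + l)) : Matrix (Fin k ⊕ Fin l) (Fin k ⊕ Fin l) F :=
  Matrix.reindex finSumFinEquiv.symm finSumFinEquiv.symm m

/-- Membership in `P_{k,l}` : being block upper triangular with blocks of sizes `k, l`. -/
def IsBUT (k l : ℕ) (m : gl F (k + l)) : Prop := Matrix.toBlocks₂₁ (blk k l m) = 0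

/-- The projection `π : P_{k,l} → gl_k(F) × gl_l(F)` deleting the off-diagonal block. -/
def proj (k l : ℕ) (m : gl F (k + l)) : gl F k × gl F l :=
  (Matrix.toBlocks₁₁ (blk k l m), Matrix.toBlocks₂₂ (blk k l m))

/-- The order of the group `P^×_{k,l}` of invertible block upper-triangular matrices. -/
noncomputable def Pcard (F : Type) [Field F] [Fintype F] [DecidableEq F] (k l : ℕ) : ℕ :=
  Nat.card {g : Matrix.GeneralLinearGroup (Fin (k + l)) F //
    IsBUT k l (g : Matrix (Fin (k + l)) (Fin (k + l)) F)}

/-- Harish-Chandra restriction `*R^{k+l}_{k,l}`; by convention it is the identity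
(under the canonical identifications) when `k = 0` or `l = 0`. -/
noncomputable def HCres (k l : ℕ) (f : gl F (k + l) → ℂ) : gl F k × gl F l → ℂ :=
  if hk : k = 0 then fun p => f (castM (by omega) p.2)
  else if hl : l = 0 then fun p => f (castM (by omega) p.1)
  else fun p =>
    ((Fintype.card F : ℂ) ^ (k * l))⁻¹ * ∑ u : Matrix (Fin k) (Fin l) F, f (but k l p.1 u p.2)

/-- Harish-Chandra induction `R^{k+l}_{k,l}`; by convention it is the identity
(under the canonical identifications) when `k = 0` or `l = 0`. -/
noncomputable def HCind (k l : ℕ) (h : gl F k × gl F l → ℂ) : gl F (k + l) → ℂ :=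
  if hk : k = 0 then fun z => h (0, castM (by omega) z)
  else if hl : l = 0 then fun z => h (castM (by omega) z, 0)
  else fun z =>
    ((Pcard F k l : ℂ))⁻¹ *
      ∑ g : Matrix.GeneralLinearGroup (Fin (k + l)) F,
        if IsBUT k l (conjM g z) then h (proj k l (conjM g z)) else 0

/-- The hermitian inner product on `C_n`. -/
noncomputable def inn (n : ℕ) (f g : gl F n → ℂ) : ℂ :=
  ((Fintype.card (Matrix.GeneralLinearGroup (Fin n) F) : ℂ))⁻¹ *
    ∑ x : gl F n, f x * (starRingEnd ℂ) (g x)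

/-- The hermitian inner product on invariant functions on `gl_k(F) × gl_l(F)`. -/
noncomputable def inn₂ (k l : ℕ) (f g : gl F k × gl F l → ℂ) : ℂ :=
  ((Fintype.card (Matrix.GeneralLinearGroup (Fin k) F) *
      Fintype.card (Matrix.GeneralLinearGroup (Fin l) F) : ℂ))⁻¹ *
    ∑ p : gl F k × gl F l, f p * (starRingEnd ℂ) (g p)

/-- `f ∈ C_n` is pre-cuspidal if all proper Harish-Chandra restrictions of `f` vanish. -/
def PreCuspidal (n : ℕ) (f : gl F n → ℂ) : Prop :=
  ∀ (k l : ℕ), 1 ≤ k → 1 ≤ l → ∀ hkl : k + l = n, HCres k l (castFun hkl.symm f) = 0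

/-- The composite `R_{(n_1,…,n_r)} ∘ *R_{(n_1,…,n_r)}` of the iterated two-block
Harish-Chandra induction and restriction along the composition `(n_1,…,n_r)`. -/
noncomputable def RcompRes : (L : List ℕ) → (gl F L.sum → ℂ) → gl F L.sum → ℂ
  | [], f => f
  | (k :: L), f =>
      castFun (List.sum_cons).symm
        (HCind k L.sum fun p =>
          RcompRes L (fun y => HCres k L.sum (castFun List.sum_cons f) (p.1, y)) p.2)

/-- The duality operation `𝒟_n(f) = Σ_{(n_1,…,n_r) ⊨ n} (-1)^{n-r}
R_{(n_1,…,n_r)}(*R_{(n_1,…,n_r)} f)`, the sum over all compositions of `n`. -/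
noncomputable def Dual (n : ℕ) (f : gl F n → ℂ) : gl F n → ℂ :=
  ∑ c : Composition n,
    ((-1 : ℂ)) ^ (n - c.length) •
      castFun c.blocks_sum (RcompRes c.blocks (castFun c.blocks_sum.symm f))

/-- `C_n`, the subspace of invariant functions, as a `ℂ`-submodule of all functions. -/
noncomputable def InvSub (F : Type) [Field F] (n : ℕ) : Submodule ℂ (gl F n → ℂ) where
  carrier := {f | Invariant n f}
  add_mem' := by
    intro a b ha hb g x
    simp only [Pi.add_apply]
    rw [ha g x, hb g x]
  zero_mem' := by intro g x; rfl
  smul_mem' := by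
    intro c f hf g x
    simp only [Pi.smul_apply]
    rw [hf g x]

/-- `χ` is the character of a finite-dimensional complex representation of the
additive group `gl_n(F)`. -/
def IsChar (n : ℕ) (χ : gl F n → ℂ) : Prop :=
  ∃ V : FDRep ℂ (Multiplicative (gl F n)),
    ∀ x : gl F n, FDRep.character V (Multiplicative.ofAdd x) = χ x

/-- An invariant character of `gl_n(F)`. -/
def IsInvChar (n : ℕ) (χ : gl F n → ℂ) : Prop := IsChar n χ ∧ Invariant n χ

/-- A character of the additive group `gl_k(F) × gl_l(F)`. -/
def IsChar₂ (k l : ℕ) (χ : gl F k × gl F l → ℂ) : Prop :=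
  ∃ V : FDRep ℂ (Multiplicative (gl F k × gl F l)),
    ∀ p : gl F k × gl F l, FDRep.character V (Multiplicative.ofAdd p) = χ p

/-- An invariant character of `gl_k(F) × gl_l(F)`. -/
def IsInvChar₂ (k l : ℕ) (χ : gl F k × gl F l → ℂ) : Prop := IsChar₂ k l χ ∧ Invariant₂ k l χ

/-- An irreducible invariant character: a nonzero invariant character which is not
the sum of two nonzero invariant characters. -/
def IrrInvChar (n : ℕ) (χ : gl F n → ℂ) : Prop :=
  IsInvChar n χ ∧ χ ≠ 0 ∧
    ¬ ∃ χ₁ χ₂ : gl F n → ℂ, IsInvChar n χ₁ ∧ IsInvChar n χ₂ ∧ χ₁ ≠ 0 ∧ χ₂ ≠ 0 ∧ χ = χ₁ + χ₂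


set_option linter.unusedSectionVars false

section gen

variable {α β γ : Type} [Fintype α] [DecidableEq α] [Fintype β] [DecidableEq β]
  [Fintype γ] [DecidableEq γ]

/-- Conjugation for matrices indexed by an arbitrary finite type. -/
def cj (g : Matrix.GeneralLinearGroup α F) (x : Matrix α α F) : Matrix α α F :=
  (g : Matrix α α F) * x * ((g⁻¹ : Matrix.GeneralLinearGroup α F) : Matrix α α F)

lemma cj_mul (g h : Matrix.GeneralLinearGroup α F) (x : Matrix α α F) :
    cj (g * h) x = cj g (cj h x) := by
  simp [cj, mul_assoc]

/-- Reindexing of general linear groups. -/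
def reGL (e : α ≃ β) : Matrix.GeneralLinearGroup α F ≃* Matrix.GeneralLinearGroup β F :=
  Units.mapEquiv (Matrix.reindexAlgEquiv F F e).toMulEquiv

lemma cj_reGL (e : α ≃ β) (g : Matrix.GeneralLinearGroup α F) (x : Matrix α α F) :
    cj (reGL e g) (Matrix.reindex e e x) = Matrix.reindex e e (cj g x) := by
  have h1 : ((reGL e g : Matrix.GeneralLinearGroup β F) : Matrix β β F)
      = Matrix.reindexAlgEquiv F F e (g : Matrix α α F) := rfl
  have h2 : (((reGL e g)⁻¹ : Matrix.GeneralLinearGroup β F) : Matrix β β F)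
      = Matrix.reindexAlgEquiv F F e ((g⁻¹ : Matrix.GeneralLinearGroup α F) : Matrix α α F) := by
    rw [← map_inv]; rfl
  unfold cj
  rw [h1, h2, ← Matrix.coe_reindexAlgEquiv F F, ← map_mul, ← map_mul]

lemma sum_cj_reindex (e : α ≃ β) (Φ : Matrix β β F → ℂ) (x : Matrix α α F) :
    ∑ g : Matrix.GeneralLinearGroup β F, Φ (cj g (Matrix.reindex e e x)) =
      ∑ g : Matrix.GeneralLinearGroup α F, Φ (Matrix.reindex e e (cj g x)) := by
  rw [← Equiv.sum_comp (reGL (F := F) e).toEquiv]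
  refine Finset.sum_congr rfl fun g _ => ?_
  exact congrArg Φ (cj_reGL e g x)

lemma sum_cj_shift (h : Matrix.GeneralLinearGroup α F) (Φ : Matrix α α F → ℂ)
    (x : Matrix α α F) :
    ∑ g : Matrix.GeneralLinearGroup α F, Φ (cj h (cj g x)) =
      ∑ g : Matrix.GeneralLinearGroup α F, Φ (cj g x) := by
  rw [← Equiv.sum_comp (Equiv.mulLeft h) fun g => Φ (cj g x)]
  simp [cj_mul]

/-- Block diagonal invertible matrices. -/
def dg (g : Matrix.GeneralLinearGroup α F) (h : Matrix.GeneralLinearGroup β F) :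
    Matrix.GeneralLinearGroup (α ⊕ β) F where
  val := Matrix.fromBlocks (g : Matrix α α F) 0 0 (h : Matrix β β F)
  inv := Matrix.fromBlocks ((g⁻¹ : Matrix.GeneralLinearGroup α F) : Matrix α α F) 0 0
    ((h⁻¹ : Matrix.GeneralLinearGroup β F) : Matrix β β F)
  val_inv := by
    rw [Matrix.fromBlocks_multiply, ← Units.val_mul, ← Units.val_mul]; simp
  inv_val := by
    rw [Matrix.fromBlocks_multiply, ← Units.val_mul, ← Units.val_mul]; simp

lemma cj_dg (g : Matrix.GeneralLinearGroup α F) (h : Matrix.GeneralLinearGroup β F)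
    (a : Matrix α α F) (b : Matrix α β F) (c : Matrix β α F) (d : Matrix β β F) :
    cj (dg g h) (Matrix.fromBlocks a b c d) =
      Matrix.fromBlocks (cj g a)
        ((g : Matrix α α F) * b * ((h⁻¹ : Matrix.GeneralLinearGroup β F) : Matrix β β F))
        ((h : Matrix β β F) * c * ((g⁻¹ : Matrix.GeneralLinearGroup α F) : Matrix α α F))
        (cj h d) := by
  have h1 : ((dg g h : Matrix.GeneralLinearGroup (α ⊕ β) F) : Matrix (α ⊕ β) (α ⊕ β) F) =
    Matrix.fromBlocks (g : Matrix α α F) 0 0 (h : Matrix β β F) := rfl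
  have h2 : (((dg g h)⁻¹ : Matrix.GeneralLinearGroup (α ⊕ β) F) : Matrix (α ⊕ β) (α ⊕ β) F) =
    Matrix.fromBlocks ((g⁻¹ : Matrix.GeneralLinearGroup α F) : Matrix α α F) 0 0
    ((h⁻¹ : Matrix.GeneralLinearGroup β F) : Matrix β β F) := rfl
  unfold cj
  rw [h1, h2, Matrix.fromBlocks_multiply, Matrix.fromBlocks_multiply]
  simp

lemma cj_one (x : Matrix α α F) : cj 1 x = x := by simp [cj]

lemma conj_zero_iff (g : Matrix.GeneralLinearGroup α F) (h : Matrix.GeneralLinearGroup β F)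
    (c : Matrix β α F) :
    (h : Matrix β β F) * c * ((g⁻¹ : Matrix.GeneralLinearGroup α F) : Matrix α α F) = 0 ↔
      c = 0 := by
  constructor
  · intro H
    have : ((h⁻¹ : Matrix.GeneralLinearGroup β F) : Matrix β β F) *
      ((h : Matrix β β F) * c * ((g⁻¹ : Matrix.GeneralLinearGroup α F) : Matrix α α F)) *
        (g : Matrix α α F) = c := by
      rw [Matrix.mul_assoc (h : Matrix β β F), ← Matrix.mul_assoc, ← Units.val_mul,
        Matrix.mul_assoc, Matrix.mul_assoc, ← Units.val_mul]
      simp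
    rw [← this, H]; simp
  · rintro rfl; simp

/-- The function summed in Harish-Chandra induction. -/
noncomputable def loc (h : Matrix α α F × Matrix β β F → ℂ)
    (c : Matrix (α ⊕ β) (α ⊕ β) F) : ℂ :=
  if c.toBlocks₂₁ = 0 then h (c.toBlocks₁₁, c.toBlocks₂₂) else 0

/-- Unnormalised Harish-Chandra induction. -/
noncomputable def EE (h : Matrix α α F × Matrix β β F → ℂ)
    (z : Matrix (α ⊕ β) (α ⊕ β) F) : ℂ :=
  ∑ g : Matrix.GeneralLinearGroup (α ⊕ β) F, loc h (cj g z)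

lemma EE_right (H : Matrix α α F → Matrix β β F × Matrix γ γ F → ℂ)
    (z : Matrix (α ⊕ (β ⊕ γ)) (α ⊕ (β ⊕ γ)) F) :
    EE (fun p => EE (H p.1) p.2) z =
      (Fintype.card (Matrix.GeneralLinearGroup (β ⊕ γ) F) : ℂ) *
      ∑ g : Matrix.GeneralLinearGroup (α ⊕ (β ⊕ γ)) F,
        loc (fun p => loc (H p.1) p.2) (cj g z) := by
  have key : ∀ (h : Matrix.GeneralLinearGroup (β ⊕ γ) F)
      (c : Matrix (α ⊕ (β ⊕ γ)) (α ⊕ (β ⊕ γ)) F),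
      loc (fun p => loc (H p.1) (cj h p.2)) c =
        loc (fun p => loc (H p.1) p.2) (cj (dg 1 h) c) := by
    intro h c
    rw [← Matrix.fromBlocks_toBlocks c, cj_dg]
    simp only [loc, Matrix.toBlocks_fromBlocks₁₁, Matrix.toBlocks_fromBlocks₂₁,
      Matrix.toBlocks_fromBlocks₂₂, cj_one, conj_zero_iff]
    congr 1
  have h1 : EE (fun p => EE (H p.1) p.2) z =
      ∑ h : Matrix.GeneralLinearGroup (β ⊕ γ) F,
        ∑ g : Matrix.GeneralLinearGroup (α ⊕ (β ⊕ γ)) F,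
          loc (fun p => loc (H p.1) (cj h p.2)) (cj g z) := by
    rw [Finset.sum_comm]
    unfold EE
    refine Finset.sum_congr rfl fun g _ => ?_
    conv_lhs => unfold loc
    conv_rhs => enter [2, h]; rw [loc]
    by_cases hc : (cj g z).toBlocks₂₁ = 0
    · simp only [if_pos hc, loc]
    · simp only [if_neg hc, Finset.sum_const_zero]
  rw [h1]
  simp only [key]
  simp only [sum_cj_shift _ (fun c => loc (fun p => loc (H p.1) p.2) c)]
  simp

lemma EE_left (H : Matrix γ γ F → Matrix α α F × Matrix β β F → ℂ)
    (z : Matrix ((α ⊕ β) ⊕ γ) ((α ⊕ β) ⊕ γ) F) :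
    EE (fun p => EE (H p.2) p.1) z =
      (Fintype.card (Matrix.GeneralLinearGroup (α ⊕ β) F) : ℂ) *
      ∑ g : Matrix.GeneralLinearGroup ((α ⊕ β) ⊕ γ) F,
        loc (fun p => loc (H p.2) p.1) (cj g z) := by
  have key : ∀ (h : Matrix.GeneralLinearGroup (α ⊕ β) F)
      (c : Matrix ((α ⊕ β) ⊕ γ) ((α ⊕ β) ⊕ γ) F),
      loc (fun p => loc (H p.2) (cj h p.1)) c =
        loc (fun p => loc (H p.2) p.1) (cj (dg h 1) c) := by
    intro h c
    rw [← Matrix.fromBlocks_toBlocks c, cj_dg]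
    simp only [loc, Matrix.toBlocks_fromBlocks₁₁, Matrix.toBlocks_fromBlocks₂₁,
      Matrix.toBlocks_fromBlocks₂₂, cj_one, conj_zero_iff]
    congr 1
  have h1 : EE (fun p => EE (H p.2) p.1) z =
      ∑ h : Matrix.GeneralLinearGroup (α ⊕ β) F,
        ∑ g : Matrix.GeneralLinearGroup ((α ⊕ β) ⊕ γ) F,
          loc (fun p => loc (H p.2) (cj h p.1)) (cj g z) := by
    rw [Finset.sum_comm]
    unfold EE
    refine Finset.sum_congr rfl fun g _ => ?_
    conv_lhs => unfold loc
    conv_rhs => enter [2, h]; rw [loc]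
    by_cases hc : (cj g z).toBlocks₂₁ = 0
    · simp only [if_pos hc, loc]
    · simp only [if_neg hc, Finset.sum_const_zero]
  rw [h1]
  simp only [key]
  simp only [sum_cj_shift _ (fun c => loc (fun p => loc (H p.2) p.1) c)]
  simp

lemma loc_assoc (H : Matrix α α F → Matrix β β F → Matrix γ γ F → ℂ)
    (c : Matrix ((α ⊕ β) ⊕ γ) ((α ⊕ β) ⊕ γ) F) :
    loc (fun p => loc (fun q => H p.1 q.1 q.2) p.2)
      (Matrix.reindex (Equiv.sumAssoc α β γ) (Equiv.sumAssoc α β γ) c) =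
    loc (fun p => loc (fun q => H q.1 q.2 p.2) p.1) c := by
  unfold loc
  rw [← ite_and, ← ite_and]
  refine if_congr ?_ rfl rfl
  simp only [← Matrix.ext_iff]
  constructor
  · rintro ⟨h1, h2⟩
    refine ⟨?_, ?_⟩
    · rintro i (j | j)
      · exact h1 (Sum.inr i) j
      · exact h2 i j
    · intro i j
      exact h1 (Sum.inl i) j
  · rintro ⟨h1, h2⟩
    refine ⟨?_, ?_⟩
    · rintro (i | i) j
      · exact h2 i j
      · exact h1 i (Sum.inl j)
    · intro i j
      exact h1 i (Sum.inr j)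

lemma EE_assoc (H : Matrix α α F → Matrix β β F → Matrix γ γ F → ℂ)
    (z : Matrix ((α ⊕ β) ⊕ γ) ((α ⊕ β) ⊕ γ) F) :
    (Fintype.card (Matrix.GeneralLinearGroup (α ⊕ β) F) : ℂ) *
      EE (fun p => EE (fun q => H p.1 q.1 q.2) p.2)
        (Matrix.reindex (Equiv.sumAssoc α β γ) (Equiv.sumAssoc α β γ) z) =
    (Fintype.card (Matrix.GeneralLinearGroup (β ⊕ γ) F) : ℂ) *
      EE (fun p => EE (fun q => H q.1 q.2 p.2) p.1) z := by
  rw [EE_right (fun x q => H x q.1 q.2), EE_left (fun z' q => H q.1 q.2 z'),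
    sum_cj_reindex _ (fun c => loc (fun p => loc (fun q => H p.1 q.1 q.2) p.2) c)]
  simp only [loc_assoc]
  ring

variable {α' β' : Type} [Fintype α'] [DecidableEq α'] [Fintype β'] [DecidableEq β']

lemma EE_congr (e₁ : α ≃ α') (e₂ : β ≃ β') (h : Matrix α' α' F × Matrix β' β' F → ℂ)
    (z : Matrix (α ⊕ β) (α ⊕ β) F) :
    EE h (Matrix.reindex (Equiv.sumCongr e₁ e₂) (Equiv.sumCongr e₁ e₂) z) =
      EE (fun p => h (Matrix.reindex e₁ e₁ p.1, Matrix.reindex e₂ e₂ p.2)) z := by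
  unfold EE
  rw [sum_cj_reindex]
  refine Finset.sum_congr rfl fun g _ => ?_
  unfold loc
  refine if_congr ?_ rfl rfl
  simp only [← Matrix.ext_iff]
  constructor
  · intro H i j
    simpa [Matrix.toBlocks₂₁] using H (e₂ i) (e₁ j)
  · intro H i j
    simpa [Matrix.toBlocks₂₁] using H (e₂.symm i) (e₁.symm j)

/-- Invertible block triangular matrices. -/
noncomputable def butEquiv : (Matrix.GeneralLinearGroup α F × Matrix.GeneralLinearGroup β F) × Matrix α β F ≃
    {g : Matrix.GeneralLinearGroup (α ⊕ β) F //
      (g : Matrix (α ⊕ β) (α ⊕ β) F).toBlocks₂₁ = 0} := by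
  refine Equiv.ofBijective (fun p => ⟨Matrix.GeneralLinearGroup.mk''
    (Matrix.fromBlocks (p.1.1 : Matrix α α F) p.2 0 (p.1.2 : Matrix β β F)) ?_, ?_⟩) ⟨?_, ?_⟩
  · rw [Matrix.det_fromBlocks_zero₂₁]
    exact ((Matrix.isUnit_iff_isUnit_det _).1 p.1.1.isUnit).mul
      ((Matrix.isUnit_iff_isUnit_det _).1 p.1.2.isUnit)
  · exact Matrix.toBlocks_fromBlocks₂₁ _ _ _ _
  · rintro ⟨⟨a, b⟩, u⟩ ⟨⟨a', b'⟩, u'⟩ h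
    have h1 := congrArg (fun g => (g.1 : Matrix (α ⊕ β) (α ⊕ β) F)) h
    have h2 : Matrix.fromBlocks (a : Matrix α α F) u 0 (b : Matrix β β F) =
      Matrix.fromBlocks (a' : Matrix α α F) u' 0 (b' : Matrix β β F) := h1
    rw [Matrix.fromBlocks_inj] at h2
    obtain ⟨h3, h4, -, h5⟩ := h2
    simp only [Prod.mk.injEq]
    exact ⟨⟨Units.ext h3, Units.ext h5⟩, h4⟩
  · rintro ⟨g, hg⟩
    have hd := (Matrix.isUnit_iff_isUnit_det _).1 g.isUnit
    rw [← Matrix.fromBlocks_toBlocks (g : Matrix (α ⊕ β) (α ⊕ β) F), hg,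
      Matrix.det_fromBlocks_zero₂₁] at hd
    obtain ⟨h1, h2⟩ := IsUnit.mul_iff.1 hd
    refine ⟨⟨⟨Matrix.GeneralLinearGroup.mk'' _ h1, Matrix.GeneralLinearGroup.mk'' _ h2⟩,
      (g : Matrix (α ⊕ β) (α ⊕ β) F).toBlocks₁₂⟩, ?_⟩
    apply Subtype.ext
    apply Units.ext
    conv_rhs => rw [← Matrix.fromBlocks_toBlocks (g : Matrix (α ⊕ β) (α ⊕ β) F), hg]
    rfl

/-- Unnormalised restriction. -/
noncomputable def RR (f : Matrix (α ⊕ β) (α ⊕ β) F → ℂ) (x : Matrix α α F) (y : Matrix β β F) : ℂ :=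
  ∑ u : Matrix α β F, f (Matrix.fromBlocks x u 0 y)

lemma RR_congr (e₁ : α ≃ α') (e₂ : β ≃ β') (f : Matrix (α' ⊕ β') (α' ⊕ β') F → ℂ)
    (x : Matrix α α F) (y : Matrix β β F) :
    RR f (Matrix.reindex e₁ e₁ x) (Matrix.reindex e₂ e₂ y) =
      RR (fun z => f (Matrix.reindex (Equiv.sumCongr e₁ e₂) (Equiv.sumCongr e₁ e₂) z)) x y := by
  unfold RR
  rw [← Equiv.sum_comp (Matrix.reindex e₁ e₂)]
  refine Finset.sum_congr rfl fun u _ => ?_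
  congr 1
  ext (i | i) (j | j) <;> simp

lemma RR_assoc (f : Matrix (α ⊕ (β ⊕ γ)) (α ⊕ (β ⊕ γ)) F → ℂ)
    (x : Matrix α α F) (y : Matrix β β F) (z : Matrix γ γ F) :
    RR (fun w => RR (fun v => f (Matrix.reindex (Equiv.sumAssoc α β γ) (Equiv.sumAssoc α β γ) v))
      w z) x y = RR (fun w => RR f x w) y z := by
  unfold RR
  rw [← Fintype.sum_prod_type', ← Fintype.sum_prod_type']
  let E : Matrix α β F × Matrix (α ⊕ β) γ F ≃ Matrix β γ F × Matrix α (β ⊕ γ) F :=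
    { toFun := fun p => (p.2.toRows₂, Matrix.fromCols p.1 p.2.toRows₁)
      invFun := fun p => (p.2.toCols₁, Matrix.fromRows p.2.toCols₂ p.1)
      left_inv := by
        rintro ⟨a, b⟩
        simp
      right_inv := by
        rintro ⟨a, b⟩
        simp }
  rw [← Equiv.sum_comp E]
  refine Finset.sum_congr rfl fun p _ => ?_
  refine congrArg f ?_
  ext (i | i | i) (j | j | j) <;> rfl

end gen

lemma card_mat (k l : ℕ) : Fintype.card (Matrix (Fin k) (Fin l) F) = Fintype.card F ^ (k * l) := by
  rw [← Nat.card_eq_fintype_card]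
  unfold Matrix
  simp [pow_mul, mul_comm k l]

lemma Pcard_eq (k l : ℕ) : (Pcard F k l : ℂ) =
    (Fintype.card (Matrix.GeneralLinearGroup (Fin k) F) : ℂ) *
      (Fintype.card (Matrix.GeneralLinearGroup (Fin l) F) : ℂ) *
      (Fintype.card F : ℂ) ^ (k * l) := by
  have h1 : Pcard F k l = Nat.card {g : Matrix.GeneralLinearGroup (Fin k ⊕ Fin l) F //
      (g : Matrix (Fin k ⊕ Fin l) (Fin k ⊕ Fin l) F).toBlocks₂₁ = 0} := by
    unfold Pcard
    refine Nat.card_congr (Equiv.subtypeEquiv (reGL finSumFinEquiv.symm).toEquiv ?_)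
    intro g
    exact Iff.rfl
  rw [h1, ← Nat.card_congr butEquiv, Nat.card_eq_fintype_card, Fintype.card_prod,
    Fintype.card_prod]
  rw [card_mat]
  push_cast
  ring

lemma HCind_eq (k l : ℕ) (hk : k ≠ 0) (hl : l ≠ 0) (h : gl F k × gl F l → ℂ)
    (z : gl F (k + l)) :
    HCind k l h z = ((Pcard F k l : ℂ))⁻¹ * EE h (blk k l z) := by
  unfold HCind
  rw [dif_neg hk, dif_neg hl]
  congr 1
  unfold EE blk
  rw [sum_cj_reindex]
  refine Finset.sum_congr rfl fun g _ => ?_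
  unfold loc
  refine if_congr Iff.rfl rfl rfl

lemma EE_smul {α β : Type} [Fintype α] [DecidableEq α] [Fintype β] [DecidableEq β] (c : ℂ)
    (h : Matrix α α F × Matrix β β F → ℂ) (z : Matrix (α ⊕ β) (α ⊕ β) F) :
    EE (fun p => c * h p) z = c * EE h z := by
  unfold EE loc
  rw [Finset.mul_sum]
  refine Finset.sum_congr rfl fun g _ => ?_
  split_ifs <;> simp

lemma card_GL_congr {α β : Type} [Fintype α] [DecidableEq α] [Fintype β] [DecidableEq β]
    (e : α ≃ β) : Fintype.card (Matrix.GeneralLinearGroup α F) =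
      Fintype.card (Matrix.GeneralLinearGroup β F) :=
  Fintype.card_congr (reGL e).toEquiv

lemma assoc_compat (k l m : ℕ) (i : (Fin k ⊕ Fin l) ⊕ Fin m) :
    (finCongr (add_assoc k l m)) (finSumFinEquiv (Sum.map finSumFinEquiv id i)) =
      finSumFinEquiv (Sum.map id finSumFinEquiv (Equiv.sumAssoc _ _ _ i)) := by
  rcases i with (i | i) | i <;> ext <;> simp [add_assoc]

lemma reindex_compat (k l m : ℕ) (z : gl F (k + (l + m))) :
    Matrix.reindex (Equiv.sumAssoc (Fin k) (Fin l) (Fin m)) (Equiv.sumAssoc (Fin k) (Fin l) (Fin m))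
      (Matrix.reindex (Equiv.sumCongr finSumFinEquiv.symm (Equiv.refl (Fin m)))
        (Equiv.sumCongr finSumFinEquiv.symm (Equiv.refl (Fin m)))
        (blk (k + l) m (castM (add_assoc k l m).symm z))) =
    Matrix.reindex (Equiv.sumCongr (Equiv.refl (Fin k)) finSumFinEquiv.symm)
        (Equiv.sumCongr (Equiv.refl (Fin k)) finSumFinEquiv.symm)
        (blk k (l + m) z) := by
  have key : ∀ i : Fin k ⊕ (Fin l ⊕ Fin m),
      (finCongr (add_assoc k l m)) (finSumFinEquiv (Sum.map finSumFinEquiv id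
        ((Equiv.sumAssoc _ _ _).symm i))) = finSumFinEquiv (Sum.map id finSumFinEquiv i) := by
    intro i
    rw [assoc_compat]; simp
  ext i j
  exact congrArg₂ z (key i) (key j)

lemma HCind_assoc (k l m : ℕ) (hk : k ≠ 0) (hl : l ≠ 0) (hm : m ≠ 0)
    (H : gl F k → gl F l → gl F m → ℂ) :
    HCind k (l + m) (fun p => HCind l m (fun q => H p.1 q.1 q.2) p.2) =
      castFun (add_assoc k l m)
        (HCind (k + l) m (fun p => HCind k l (fun q => H q.1 q.2 p.2) p.1)) := by
  funext z
  unfold castFun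
  rw [HCind_eq k (l + m) hk (by omega), HCind_eq (k + l) m (by omega) hm]
  simp only [HCind_eq l m hl hm, HCind_eq k l hk hl]
  rw [EE_smul, EE_smul]
  have hL := EE_congr (Equiv.refl (Fin k)) (finSumFinEquiv (m := l) (n := m)).symm
    (fun p => EE (fun q => H p.1 q.1 q.2) p.2) (blk k (l + m) z)
  have hR := EE_congr (finSumFinEquiv (m := k) (n := l)).symm (Equiv.refl (Fin m))
    (fun p => EE (fun q => H q.1 q.2 p.2) p.1) (blk (k + l) m (castM (add_assoc k l m).symm z))
  have hA := EE_assoc H (Matrix.reindex (Equiv.sumCongr finSumFinEquiv.symm (Equiv.refl (Fin m)))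
        (Equiv.sumCongr finSumFinEquiv.symm (Equiv.refl (Fin m)))
        (blk (k + l) m (castM (add_assoc k l m).symm z)))
  rw [reindex_compat, hL, hR] at hA
  change _ * EE (fun p => EE (fun q => H p.1 q.1 q.2) (blk l m p.2)) (blk k (l + m) z) =
    _ * EE (fun p => EE (fun q => H q.1 q.2 p.2) (blk k l p.1))
      (blk (k + l) m (castM (add_assoc k l m).symm z)) at hA
  rw [card_GL_congr finSumFinEquiv, card_GL_congr (finSumFinEquiv (m := l) (n := m))] at hA
  generalize EE (fun p => EE (fun q => H p.1 q.1 q.2) (blk l m p.2)) (blk k (l + m) z) = A at *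
  generalize EE (fun p => EE (fun q => H q.1 q.2 p.2) (blk k l p.1))
      (blk (k + l) m (castM (add_assoc k l m).symm z)) = B at *
  have hc : ∀ n : ℕ, (Fintype.card (Matrix.GeneralLinearGroup (Fin n) F) : ℂ) ≠ 0 := fun n =>
    Nat.cast_ne_zero.2 Fintype.card_ne_zero
  have hq : (Fintype.card F : ℂ) ≠ 0 := Nat.cast_ne_zero.2 Fintype.card_ne_zero
  simp only [Pcard_eq]
  have h1 := hc k
  have h2 := hc l
  have h3 := hc m
  have h4 := hc (k + l)
  have h5 := hc (l + m)
  generalize (Fintype.card (Matrix.GeneralLinearGroup (Fin k) F) : ℂ) = a at *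
  generalize (Fintype.card (Matrix.GeneralLinearGroup (Fin l) F) : ℂ) = b at *
  generalize (Fintype.card (Matrix.GeneralLinearGroup (Fin m) F) : ℂ) = c at *
  generalize (Fintype.card (Matrix.GeneralLinearGroup (Fin (k + l)) F) : ℂ) = d at *
  generalize (Fintype.card (Matrix.GeneralLinearGroup (Fin (l + m)) F) : ℂ) = e at *
  generalize (Fintype.card F : ℂ) = q at *
  have hB : B = d * A / e := by
    field_simp; linear_combination -hA
  rw [hB]
  simp only [mul_add, add_mul, pow_add]
  field_simp

lemma castM_rfl {n : ℕ} (h : n = n) (x : gl F n) : castM h x = x := by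
  ext i j; rfl

lemma castFun_rfl {n : ℕ} (h : n = n) (f : gl F n → ℂ) : castFun h f = f := by
  funext x; simp [castFun, castM_rfl]

lemma castM_castM {a b c : ℕ} (h : a = b) (h' : b = c) (x : gl F a) :
    castM h' (castM h x) = castM (h.trans h') x := by
  ext i j; rfl

lemma castFun_castFun {a b c : ℕ} (h : a = b) (h' : b = c) (f : gl F a → ℂ) :
    castFun h' (castFun h f) = castFun (h.trans h') f := by
  funext x; simp [castFun, castM_castM]

lemma HCind_cast {k k' l l' : ℕ} (hk : k = k') (hl : l = l') (h : gl F k' × gl F l' → ℂ) :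
    HCind k' l' h = castFun (by rw [hk, hl])
      (HCind k l (fun p => h (castM hk p.1, castM hl p.2))) := by
  subst hk hl
  simp [castM_rfl, castFun_rfl]

lemma HCres_cast {k k' l l' : ℕ} (hk : k = k') (hl : l = l') (e : k + l = k' + l')
    (f : gl F (k + l) → ℂ) (x : gl F k) (y : gl F l) :
    HCres k' l' (castFun e f) (castM hk x, castM hl y) = HCres k l f (x, y) := by
  subst hk hl
  simp [castM_rfl, castFun_rfl]

lemma HCind_zero_left (l : ℕ) (h : gl F 0 × gl F l → ℂ) :
    HCind 0 l h = castFun (by omega) (fun z => h (0, z)) := by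
  unfold HCind; rw [dif_pos rfl]; rfl

lemma HCind_zero_right (k : ℕ) (h : gl F k × gl F 0 → ℂ) :
    HCind k 0 h = fun z => h (z, 0) := by
  unfold HCind
  by_cases hk : k = 0
  · subst hk
    rw [dif_pos rfl]
    funext z
    congr 1
    exact Prod.ext (Subsingleton.elim _ _) (Subsingleton.elim _ _)
  · rw [dif_neg hk, dif_pos rfl]
    funext z
    rw [castM_rfl]

lemma HCind_assoc' (k l m : ℕ) (hk : k ≠ 0) (hm : m ≠ 0)
    (H : gl F k → gl F l → gl F m → ℂ) :
    HCind k (l + m) (fun p => HCind l m (fun q => H p.1 q.1 q.2) p.2) =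
      castFun (add_assoc k l m)
        (HCind (k + l) m (fun p => HCind k l (fun q => H q.1 q.2 p.2) p.1)) := by
  by_cases hl : l = 0
  · subst hl
    rw [HCind_cast (rfl : k = k) (Nat.zero_add m).symm]
    simp only [HCind_zero_left, HCind_zero_right, castFun, castM_castM, castM_rfl]
    rfl
  · exact HCind_assoc k l m hk hl hm H

lemma HCres_eq (k l : ℕ) (f : gl F (k + l) → ℂ) (x : gl F k) (y : gl F l) :
    HCres k l f (x, y) = ((Fintype.card F : ℂ) ^ (k * l))⁻¹ *
      RR (fun z => f (Matrix.reindex finSumFinEquiv finSumFinEquiv z)) x y := by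
  unfold HCres RR
  by_cases hk : k = 0
  · subst hk
    rw [dif_pos rfl]
    have : ∀ u : Matrix (Fin 0) (Fin l) F,
        Matrix.reindex finSumFinEquiv finSumFinEquiv (Matrix.fromBlocks x u 0 y)
          = castM (Nat.zero_add l).symm y := by
      intro u
      refine (Equiv.symm_apply_eq (Matrix.reindex finSumFinEquiv finSumFinEquiv)).1 ?_ |>.symm
      ext (i | i) (j | j)
      · exact i.elim0
      · exact i.elim0
      · exact j.elim0
      · simp only [castM, Matrix.reindex_symm, Matrix.reindex_apply, Matrix.submatrix_apply,
          Equiv.symm_symm, Matrix.fromBlocks_apply₂₂]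
        congr 1 <;> ext <;> simp
    simp only [this]
    simp [card_mat]
  · by_cases hl : l = 0
    · subst hl
      rw [dif_neg hk, dif_pos rfl]
      have : ∀ u : Matrix (Fin k) (Fin 0) F,
          Matrix.reindex finSumFinEquiv finSumFinEquiv (Matrix.fromBlocks x u 0 y)
            = castM rfl x := by
        intro u
        refine (Equiv.symm_apply_eq (Matrix.reindex finSumFinEquiv finSumFinEquiv)).1 ?_ |>.symm
        ext (i | i) (j | j)
        · simp only [castM, Matrix.reindex_symm, Matrix.reindex_apply, Matrix.submatrix_apply,
            Equiv.symm_symm, Matrix.fromBlocks_apply₁₁]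
          congr 1 
        · exact j.elim0
        · exact i.elim0
        · exact i.elim0
      simp only [this]
      simp [card_mat]
    · rw [dif_neg hk, dif_neg hl]
      rfl

lemma RR_smul {α β : Type} [Fintype α] [DecidableEq α] [Fintype β] [DecidableEq β] (c : ℂ)
    (f : Matrix (α ⊕ β) (α ⊕ β) F → ℂ) (x : Matrix α α F) (y : Matrix β β F) :
    RR (fun z => c * f z) x y = c * RR f x y := by
  unfold RR
  rw [Finset.mul_sum]

lemma reindex_compat2 (k l m : ℕ) (v : Matrix ((Fin k ⊕ Fin l) ⊕ Fin m) ((Fin k ⊕ Fin l) ⊕ Fin m) F) :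
    castM (add_assoc k l m) (Matrix.reindex finSumFinEquiv finSumFinEquiv
      (Matrix.reindex (Equiv.sumCongr finSumFinEquiv (Equiv.refl (Fin m)))
        (Equiv.sumCongr finSumFinEquiv (Equiv.refl (Fin m))) v)) =
    Matrix.reindex finSumFinEquiv finSumFinEquiv
      (Matrix.reindex (Equiv.sumCongr (Equiv.refl (Fin k)) finSumFinEquiv)
        (Equiv.sumCongr (Equiv.refl (Fin k)) finSumFinEquiv)
        (Matrix.reindex (Equiv.sumAssoc (Fin k) (Fin l) (Fin m))
          (Equiv.sumAssoc (Fin k) (Fin l) (Fin m)) v)) := by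
  have key : ((Equiv.sumCongr (finSumFinEquiv (m := k) (n := l)) (Equiv.refl (Fin m))).trans
      finSumFinEquiv).trans (finCongr (add_assoc k l m)) =
    ((Equiv.sumAssoc (Fin k) (Fin l) (Fin m)).trans
      (Equiv.sumCongr (Equiv.refl (Fin k)) finSumFinEquiv)).trans finSumFinEquiv := by
    ext i
    exact congrArg Fin.val (assoc_compat k l m i)
  exact congrArg (fun e => Matrix.reindex e e v) key

lemma HCres_assoc (k l m : ℕ) (f : gl F (k + (l + m)) → ℂ) (x : gl F k) (y : gl F l)
    (z : gl F m) :
    HCres k l (fun w => HCres (k + l) m (castFun (add_assoc k l m).symm f) (w, z)) (x, y) =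
      HCres l m (fun y' => HCres k (l + m) f (x, y')) (y, z) := by
  simp only [HCres_eq, RR_smul]
  have h1 : ∀ w : Matrix (Fin k ⊕ Fin l) (Fin k ⊕ Fin l) F,
      RR (fun v => castFun (add_assoc k l m).symm f
        (Matrix.reindex finSumFinEquiv finSumFinEquiv v))
        (Matrix.reindex finSumFinEquiv finSumFinEquiv w) z =
      RR (fun v => f (Matrix.reindex finSumFinEquiv finSumFinEquiv
      (Matrix.reindex (Equiv.sumCongr (Equiv.refl (Fin k)) finSumFinEquiv)
        (Equiv.sumCongr (Equiv.refl (Fin k)) finSumFinEquiv)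
        (Matrix.reindex (Equiv.sumAssoc (Fin k) (Fin l) (Fin m))
          (Equiv.sumAssoc (Fin k) (Fin l) (Fin m)) v)))) w z := by
    intro w
    refine (RR_congr finSumFinEquiv (Equiv.refl (Fin m)) _ w z).trans ?_
    simp only [castFun, reindex_compat2]
  have h2 : ∀ w : Matrix (Fin l ⊕ Fin m) (Fin l ⊕ Fin m) F,
      RR (fun v => f (Matrix.reindex finSumFinEquiv finSumFinEquiv v)) x
        (Matrix.reindex finSumFinEquiv finSumFinEquiv w) =
      RR (fun v => f (Matrix.reindex finSumFinEquiv finSumFinEquiv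
      (Matrix.reindex (Equiv.sumCongr (Equiv.refl (Fin k)) finSumFinEquiv)
        (Equiv.sumCongr (Equiv.refl (Fin k)) finSumFinEquiv) v))) x w := by
    intro w
    exact RR_congr (Equiv.refl (Fin k)) finSumFinEquiv _ x w
  simp only [h1, h2]
  rw [RR_assoc (fun v => f (Matrix.reindex finSumFinEquiv finSumFinEquiv
      (Matrix.reindex (Equiv.sumCongr (Equiv.refl (Fin k)) finSumFinEquiv)
        (Equiv.sumCongr (Equiv.refl (Fin k)) finSumFinEquiv) v)))]
  rw [← mul_assoc, ← mul_assoc, ← mul_inv, ← mul_inv, ← pow_add, ← pow_add]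
  congr 3
  ring

lemma HCres_zero_left (l : ℕ) (f : gl F (0 + l) → ℂ) (x : gl F 0) (y : gl F l) :
    HCres 0 l f (x, y) = f (castM (by omega) y) := by
  unfold HCres; rw [dif_pos rfl]

lemma HCres_zero_right (k : ℕ) (hk : k ≠ 0) (f : gl F (k + 0) → ℂ) (x : gl F k) (y : gl F 0) :
    HCres k 0 f (x, y) = f x := by
  unfold HCres; rw [dif_neg hk, dif_pos rfl]
  simp [castM_rfl]

lemma RcompRes_append (L : List ℕ) (hL : ∀ i ∈ L, i ≠ 0) (m : ℕ) (hm : m ≠ 0)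
    (e : L.sum + m = (L ++ [m]).sum) (f : gl F (L ++ [m]).sum → ℂ) :
    RcompRes (L ++ [m]) f = castFun e (HCind L.sum m (fun p =>
      RcompRes L (fun x => HCres L.sum m (castFun e.symm f) (x, p.2)) p.1)) := by
  induction L with
  | nil =>
    funext z
    simp only [List.nil_append, RcompRes, List.sum_nil, HCind_zero_left, HCind_zero_right,
      castFun, HCres_zero_left, HCres_zero_right _ hm, castM_castM]
    rfl
  | cons k L ih =>
    have hk : k ≠ 0 := hL k (by simp)
    have e' : L.sum + m = (L ++ [m]).sum := by simp
    have ih' := ih (fun i hi => hL i (by simp [hi])) e'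
    have e1 : (k :: (L ++ [m])).sum = k + (L.sum + m) := by simp
    have e2 : (k :: (L ++ [m])).sum = (k + L.sum) + m := by simp [add_assoc]
    have hT : RcompRes (k :: (L ++ [m])) f = castFun e1.symm (HCind k (L.sum + m) (fun p =>
        HCind L.sum m (fun q => RcompRes L (fun x => HCres L.sum m
          (fun y' => HCres k (L.sum + m) (castFun e1 f) (p.1, y')) (x, q.2)) q.1) p.2)) := by
      rw [RcompRes]
      simp only [ih']
      rw [HCind_cast (rfl : k = k) e', castFun_castFun]
      refine congrArg (castFun _) (congrArg (HCind k (L.sum + m)) (funext fun p => ?_))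
      simp only [castFun, castM_castM, castM_rfl]
      refine congrArg (fun G => HCind L.sum m G p.2) (funext fun q => ?_)
      refine congrArg (fun G => RcompRes L G q.1) (funext fun x => ?_)
      refine congrArg (fun G => HCres L.sum m G (x, q.2)) (funext fun y' => ?_)
      have := HCres_cast (rfl : k = k) e' (by rw [e']) (castFun e1 f) p.1 y'
      rw [castFun_castFun, castM_rfl] at this
      exact this
    have hR : castFun e (HCind (k :: L).sum m (fun p =>
      RcompRes (k :: L) (fun x => HCres (k :: L).sum m (castFun e.symm f) (x, p.2)) p.1)) =
      castFun e2.symm (HCind (k + L.sum) m (fun p => HCind k L.sum (fun q =>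
        RcompRes L (fun x => HCres k L.sum (fun w => HCres (k + L.sum) m (castFun e2 f) (w, p.2))
          (q.1, x)) q.2) p.1)) := rfl
    refine Eq.trans (b := _) hT (Eq.trans ?_ hR.symm)
    clear hR hT
    rw [HCind_assoc' k L.sum m hk hm (fun a b c => RcompRes L (fun x => HCres L.sum m
          (fun y' => HCres k (L.sum + m) (castFun e1 f) (a, y')) (x, c)) b), castFun_castFun]
    simp only [← HCres_assoc, castFun_castFun]

/-- Append one block to a composition of `k < n`. -/
def snocComp {n : ℕ} (k : Fin n) (c : Composition (k : ℕ)) : Composition n where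
  blocks := c.blocks ++ [n - (k : ℕ)]
  blocks_pos := by
    intro i hi
    rw [List.mem_append, List.mem_singleton] at hi
    rcases hi with hi | rfl
    · exact c.blocks_pos hi
    · have := k.isLt; omega
  blocks_sum := by
    rw [List.sum_append, c.blocks_sum, List.sum_singleton]
    have := k.isLt; omega

lemma snocComp_bijective {n : ℕ} (hn : 1 ≤ n) :
    Function.Bijective (fun p : Σ k : Fin n, Composition (k : ℕ) => snocComp p.1 p.2) := by
  constructor
  · rintro ⟨k, c⟩ ⟨k', c'⟩ h
    have h1 : c.blocks ++ [n - (k : ℕ)] = c'.blocks ++ [n - (k' : ℕ)] :=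
      congrArg Composition.blocks h
    have h2 := List.append_inj_left' h1 rfl
    have h3 : k = k' := by
      apply Fin.ext
      rw [← c.blocks_sum, ← c'.blocks_sum, h2]
    subst h3
    have : c = c' := Composition.ext h2
    rw [this]
  · intro c
    have hne : c.blocks ≠ [] := by
      intro h
      have := c.blocks_sum
      rw [h] at this
      simp at this; omega
    have hb := List.dropLast_append_getLast hne
    have hs := c.blocks_sum
    have hp : 0 < c.blocks.getLast hne := c.blocks_pos (List.getLast_mem hne)
    have hsum : c.blocks.dropLast.sum + c.blocks.getLast hne = n := by
      conv_rhs => rw [← hs, ← hb]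
      simp
    refine ⟨⟨⟨c.blocks.dropLast.sum, by omega⟩, ⟨c.blocks.dropLast, fun {i} hi =>
      c.blocks_pos (List.dropLast_subset _ hi), rfl⟩⟩, ?_⟩
    apply Composition.ext
    change c.blocks.dropLast ++ [n - c.blocks.dropLast.sum] = c.blocks
    rw [show n - c.blocks.dropLast.sum = c.blocks.getLast hne by omega, hb]

/-- Signed term attached to a list of blocks. -/
noncomputable def term (n : ℕ) (f : gl F n → ℂ) (c : Composition n) : gl F n → ℂ :=
  ((-1 : ℂ)) ^ c.length •
      castFun c.blocks_sum (RcompRes c.blocks (castFun c.blocks_sum.symm f))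

lemma Dual_eq (n : ℕ) (f : gl F n → ℂ) :
    Dual n f = ((-1 : ℂ)) ^ n • ∑ c : Composition n, term n f c := by
  unfold Dual term
  rw [Finset.smul_sum]
  refine Finset.sum_congr rfl fun c _ => ?_
  rw [smul_smul]
  congr 1
  have h := c.length_le
  obtain ⟨d, hd⟩ := Nat.exists_eq_add_of_le h
  generalize c.length = r at *
  subst hd
  rw [Nat.add_sub_cancel_left, pow_add, mul_assoc, mul_comm, mul_assoc, ← pow_add,
    Even.neg_one_pow ⟨_, rfl⟩, mul_one]

lemma HCind_smul (k l : ℕ) (a : ℂ) (h : gl F k × gl F l → ℂ) :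
    HCind k l (fun p => a * h p) = fun z => a * HCind k l h z := by
  funext z
  unfold HCind
  split_ifs
  · rfl
  · rfl
  · simp only [Finset.mul_sum]
    refine Finset.sum_congr rfl fun g _ => ?_
    split_ifs
    · ring
    · simp

lemma HCind_sum {ι : Type} (s : Finset ι) (k l : ℕ) (h : ι → gl F k × gl F l → ℂ) :
    HCind k l (fun p => ∑ i ∈ s, h i p) = fun z => ∑ i ∈ s, HCind k l (h i) z := by
  funext z
  unfold HCind
  split_ifs
  · rfl
  · rfl
  · rw [← Finset.mul_sum, Finset.sum_comm]
    refine congrArg (fun t : ℂ => (Pcard F k l : ℂ)⁻¹ * t) ?_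
    refine Finset.sum_congr rfl fun g _ => ?_
    split_ifs
    · rfl
    · simp

lemma RcompRes_cast {L : List ℕ} {k l n : ℕ} (hL : L.sum = k) (f : gl F n → ℂ)
    (e : k + l = n) (e' : L.sum + l = n) :
    castFun e (HCind k l (fun p => castFun hL (RcompRes L (castFun hL.symm
      (fun x => HCres k l (castFun e.symm f) (x, p.2)))) p.1)) =
    castFun e' (HCind L.sum l (fun p => RcompRes L
      (fun x => HCres L.sum l (castFun e'.symm f) (x, p.2)) p.1)) := by
  subst hL
  simp only [castFun_rfl]

lemma RcompRes_append_cast (L : List ℕ) (hL : ∀ i ∈ L, i ≠ 0) (m : ℕ) (hm : m ≠ 0) {n : ℕ}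
    (e : L.sum + m = n) (e' : (L ++ [m]).sum = n) (f : gl F n → ℂ) :
    castFun e' (RcompRes (L ++ [m]) (castFun e'.symm f)) = castFun e (HCind L.sum m (fun p =>
      RcompRes L (fun x => HCres L.sum m (castFun e.symm f) (x, p.2)) p.1)) := by
  subst e'
  simp only [castFun_rfl]
  exact RcompRes_append L hL m hm e f

lemma term_snoc {n : ℕ} (f : gl F n → ℂ) (k : Fin n) (c : Composition (k : ℕ))
    (e : (k : ℕ) + (n - (k : ℕ)) = n) :
    castFun e (HCind (k : ℕ) (n - (k : ℕ)) (fun p =>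
      term (k : ℕ) (fun x => HCres (k : ℕ) (n - (k : ℕ)) (castFun e.symm f) (x, p.2)) c p.1)) =
    - term n f (snocComp k c) := by
  have hk := k.isLt
  have e' : c.blocks.sum + (n - (k : ℕ)) = n := by rw [c.blocks_sum]; omega
  have h1 := RcompRes_cast (F := F) c.blocks_sum f e e'
  have h2 := RcompRes_append_cast (F := F) c.blocks (fun i hi => (c.blocks_pos hi).ne') (n - (k : ℕ))
    (by omega) e' (snocComp k c).blocks_sum f
  unfold term
  have hlen : (snocComp k c).length = c.length + 1 := by
    simp [Composition.length, snocComp]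
  rw [hlen]
  have h3 : castFun (snocComp k c).blocks_sum (RcompRes (snocComp k c).blocks
      (castFun (snocComp k c).blocks_sum.symm f)) =
      castFun e' (HCind c.blocks.sum (n - (k : ℕ)) (fun p => RcompRes c.blocks
      (fun x => HCres c.blocks.sum (n - (k : ℕ)) (castFun e'.symm f) (x, p.2)) p.1)) := by
    change castFun (snocComp k c).blocks_sum (RcompRes (c.blocks ++ [n - (k : ℕ)])
      (castFun (snocComp k c).blocks_sum.symm f)) = _
    exact h2
  rw [h3, ← h1]
  simp only [Pi.smul_apply, smul_eq_mul, HCind_smul]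
  funext z
  simp only [castFun, Pi.neg_apply, Pi.smul_apply, smul_eq_mul]
  ring

/-- the alternating sum of duality operations is an antipode:
`Σ_{k=0}^{n} (-1)^k R^n_{k,n-k}((𝒟_k ⊗ id)(*R^n_{k,n-k} f)) = 0` for `n ≥ 1`. -/
theorem alternating_dual_antipode (F : Type) [Field F] [Fintype F] [DecidableEq F]
    (n : ℕ) (hn : 1 ≤ n) (f : gl F n → ℂ) (hf : Invariant n f) :
    ∑ k : Fin (n + 1),
      ((-1 : ℂ)) ^ (k : ℕ) •
        castFun (Nat.add_sub_cancel' (Nat.lt_succ_iff.mp k.isLt))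
          (HCind (k : ℕ) (n - (k : ℕ)) fun p =>
            Dual (k : ℕ)
              (fun x => HCres (k : ℕ) (n - (k : ℕ))
                  (castFun (Nat.add_sub_cancel' (Nat.lt_succ_iff.mp k.isLt)).symm f)
                  (x, p.2))
              p.1) = 0 := by
  have hmain : ∀ k : Fin (n + 1), ∀ e : (k : ℕ) + (n - (k : ℕ)) = n,
      ((-1 : ℂ)) ^ (k : ℕ) •
        castFun e
          (HCind (k : ℕ) (n - (k : ℕ)) fun p =>
            Dual (k : ℕ)
              (fun x => HCres (k : ℕ) (n - (k : ℕ)) (castFun e.symm f) (x, p.2)) p.1) =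
      ∑ c : Composition (k : ℕ), castFun e (HCind (k : ℕ) (n - (k : ℕ)) (fun p =>
        term (k : ℕ)
          (fun x => HCres (k : ℕ) (n - (k : ℕ)) (castFun e.symm f) (x, p.2)) c p.1)) := by
    intro k e
    simp only [Dual_eq, Pi.smul_apply, smul_eq_mul, Finset.sum_apply, HCind_smul, HCind_sum]
    funext z
    simp only [castFun, Pi.smul_apply, smul_eq_mul, Finset.sum_apply]
    rw [← mul_assoc, ← pow_add, Even.neg_one_pow ⟨_, rfl⟩, one_mul]
  rw [Finset.sum_congr rfl fun k _ => hmain k _, Fin.sum_univ_castSucc]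
  have h1 : ∀ k : Fin n, ∑ c : Composition ((Fin.castSucc k : Fin (n + 1)) : ℕ),
      castFun (Nat.add_sub_cancel' (Nat.lt_succ_iff.mp (Fin.castSucc k).isLt))
        (HCind ((Fin.castSucc k : Fin (n + 1)) : ℕ) (n - ((Fin.castSucc k : Fin (n + 1)) : ℕ))
        (fun p => term ((Fin.castSucc k : Fin (n + 1)) : ℕ)
          (fun x => HCres ((Fin.castSucc k : Fin (n + 1)) : ℕ)
            (n - ((Fin.castSucc k : Fin (n + 1)) : ℕ))
            (castFun (Nat.add_sub_cancel' (Nat.lt_succ_iff.mp (Fin.castSucc k).isLt)).symm f)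
            (x, p.2)) c p.1)) =
      ∑ c : Composition (k : ℕ), - term n f (snocComp k c) := by
    intro k
    exact Finset.sum_congr rfl fun c _ => term_snoc f k c _
  rw [Finset.sum_congr rfl fun k _ => h1 k, ← Fintype.sum_sigma', Finset.sum_neg_distrib,
    (snocComp_bijective hn).sum_comp (fun c => term n f c), neg_add_eq_zero]
  have h2 : ∀ (l : ℕ) (hl : l = 0) (e : n + l = n) (c : Composition n),
      castFun e (HCind n l (fun p => term n
        (fun x => HCres n l (castFun e.symm f) (x, p.2)) c p.1)) = term n f c := by
    intro l hl e c
    subst hl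
    rw [HCind_zero_right]
    simp only [HCres_zero_right n (by omega), castFun_rfl]
  refine Finset.sum_congr rfl fun c _ => ?_
  exact (h2 (n - n) (Nat.sub_self n) (by omega) c).symm

end HCPaper
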